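/- Let G be a connected graph with at least 3 vertices, let u be a vertex of degree 1 in G, and let v be its unique neighbor. If M is a MEG-set of G, then M \ {v} is also a MEG-set of G. -/

import Mathlib

/-- Edge `e` is monitored by the pair `x, y` if `x ≠ y` and `e` lies on
every shortest path between `x` and `y`. -/
def Monitors {V : Type*} (G : SimpleGraph V) (x y : V) (e : Sym2 V) : Prop :=
  x ≠ y ∧ ∀ p : G.Walk x y, p.length = G.dist x y → e ∈ p.edges

/-- `M` is a monitoring edge-geodetic set of `G`. -/
def IsMEGSet {V : Type*} (G : SimpleGraph V) (M : Set V) : Prop :=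
  ∀ e ∈ G.edgeSet, ∃ x ∈ M, ∃ y ∈ M, Monitors G x y e

theorem Monitors.symm' {V : Type*} {G : SimpleGraph V} {x y : V} {e : Sym2 V}
    (h : Monitors G x y e) : Monitors G y x e := by
  refine ⟨h.1.symm, fun p hp => ?_⟩
  have := h.2 p.reverse (by rw [SimpleGraph.Walk.length_reverse, hp, SimpleGraph.dist_comm])
  simpa using this

theorem leaf_walk {V : Type*} {G : SimpleGraph V} {u v y : V} (hu : ∀ w, G.Adj u w → w = v)
    (hadj : G.Adj u v) (hy : y ≠ u) (p : G.Walk u y) :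
    ∃ q : G.Walk v y, p = SimpleGraph.Walk.cons hadj q := by
  cases p with
  | nil => exact absurd rfl hy
  | cons h q =>
    obtain rfl := hu _ h
    exact ⟨q, rfl⟩

theorem leaf_dist {V : Type*} {G : SimpleGraph V} {u v y : V} (hconn : G.Connected)
    (hu : ∀ w, G.Adj u w → w = v)
    (hadj : G.Adj u v) (hy : y ≠ u) : G.dist u y = G.dist v y + 1 := by
  apply le_antisymm
  · obtain ⟨q, hq⟩ := hconn.exists_walk_length_eq_dist v y
    rw [← hq]
    exact SimpleGraph.dist_le (SimpleGraph.Walk.cons hadj q)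
  · obtain ⟨p, hp⟩ := hconn.exists_walk_length_eq_dist u y
    obtain ⟨q, rfl⟩ := leaf_walk hu hadj hy p
    rw [← hp, SimpleGraph.Walk.length_cons]
    exact Nat.succ_le_succ (SimpleGraph.dist_le q)

theorem leaf_monitors {V : Type*} {G : SimpleGraph V} {u v y : V} {e : Sym2 V}
    (hconn : G.Connected) (hu : ∀ w, G.Adj u w → w = v)
    (hadj : G.Adj u v) (hy : y ≠ u) (h : Monitors G v y e) : Monitors G u y e := by
  refine ⟨hy.symm, fun p hp => ?_⟩
  obtain ⟨q, rfl⟩ := leaf_walk hu hadj hy p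
  rw [leaf_dist hconn hu hadj hy, SimpleGraph.Walk.length_cons] at hp
  rw [SimpleGraph.Walk.edges_cons]
  exact List.mem_cons_of_mem _ (h.2 q (by omega))

theorem leaf_monitors_edge {V : Type*} {G : SimpleGraph V} {u v y : V}
    (hu : ∀ w, G.Adj u w → w = v)
    (hadj : G.Adj u v) (hy : y ≠ u) : Monitors G u y s(u, v) := by
  refine ⟨hy.symm, fun p hp => ?_⟩
  obtain ⟨q, rfl⟩ := leaf_walk hu hadj hy p
  simp

theorem adj_monitors {V : Type*} {G : SimpleGraph V} {u v : V} {e : Sym2 V}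
    (hadj : G.Adj u v) (h : Monitors G u v e) : e = s(u, v) := by
  have := h.2 (SimpleGraph.Walk.cons hadj SimpleGraph.Walk.nil)
    (by simp [SimpleGraph.dist_eq_one_iff_adj.2 hadj])
  simpa using this

theorem leaf_mem {V : Type*} [DecidableEq V] {G : SimpleGraph V} {u v x y : V}
    (hconn : G.Connected) (hu : ∀ w, G.Adj u w → w = v)
    (hadj : G.Adj u v) (h : Monitors G x y s(u, v)) : x = u ∨ y = u := by
  by_contra! hne
  obtain ⟨p, hp⟩ := hconn.exists_walk_length_eq_dist x y
  have hs : u ∈ p.support := p.fst_mem_support_of_mem_edges (h.2 p hp)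
  have hl := congrArg SimpleGraph.Walk.length (p.take_spec hs)
  rw [SimpleGraph.Walk.length_append] at hl
  have h1 := SimpleGraph.dist_le (p.takeUntil u hs)
  have h2 := SimpleGraph.dist_le (p.dropUntil u hs)
  rw [SimpleGraph.dist_comm, leaf_dist hconn hu hadj hne.1] at h1
  rw [leaf_dist hconn hu hadj hne.2] at h2
  have h3 := hconn.dist_triangle (u := x) (v := v) (w := y)
  rw [SimpleGraph.dist_comm (u := x) (v := v)] at h3
  omega

/-- If `G` is connected with at least 3 vertices, `u` has degree 1 with unique
neighbor `v`, and `M` is a MEG-set of `G`, then `M \ {v}` is also a MEG-set. -/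
theorem megset_remove_neighbor_of_leaf {V : Type*} [Fintype V] [DecidableEq V]
    (G : SimpleGraph V) [DecidableRel G.Adj]
    (hconn : G.Connected) (hcard : 3 ≤ Fintype.card V)
    (u v : V) (hdeg : G.degree u = 1) (hadj : G.Adj u v)
    (M : Set V) (hM : IsMEGSet G M) : IsMEGSet G (M \ {v}) := by
  have hu : ∀ w, G.Adj u w → w = v := by
    obtain ⟨a, _, ha⟩ := SimpleGraph.degree_eq_one_iff_existsUnique_adj.1 hdeg
    intro w hw
    rw [ha w hw, ha v hadj]
  have huv : u ≠ v := hadj.ne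
  have huM : u ∈ M := by
    obtain ⟨x, hx, y, hy, h⟩ := hM s(u, v) hadj
    rcases leaf_mem hconn hu hadj h with rfl | rfl <;> assumption
  have hz : ∃ z ∈ M, z ≠ u ∧ z ≠ v := by
    obtain ⟨w, hw⟩ : ∃ w, w ∉ ({u, v} : Finset V) := by
      by_contra! hc
      have h1 := Finset.card_le_card (fun x _ => hc x : Finset.univ ⊆ ({u, v} : Finset V))
      have h2 := Finset.card_le_two (a := u) (b := v)
      rw [Finset.card_univ] at h1
      omega
    simp only [Finset.mem_insert, Finset.mem_singleton, not_or] at hw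
    obtain ⟨w', hw'⟩ : ∃ w', G.Adj w w' := by
      obtain ⟨p⟩ := hconn.preconnected w u
      cases p with
      | nil => exact absurd rfl hw.1
      | cons h q => exact ⟨_, h⟩
    obtain ⟨x, hx, y, hy, h⟩ := hM s(w, w') hw'
    by_contra! hc
    have key : s(w, w') = s(u, v) := by
      by_cases hxu : x = u
      · have hyv := hc y hy (fun hyu => h.1 (hxu.trans hyu.symm))
        subst hxu hyv
        exact adj_monitors hadj h
      · have hxv := hc x hx hxu
        have hyu : y = u := by
          by_contra hyu
          exact h.1 (hxv.trans (hc y hy hyu).symm)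
        subst hxv hyu
        exact adj_monitors hadj h.symm'
    have : w ∈ s(u, v) := key ▸ Sym2.mem_mk_left w w'
    rcases Sym2.mem_iff.1 this with h | h
    · exact hw.1 h
    · exact hw.2 h
  have main : ∀ (e : Sym2 V) (y : V), y ∈ M → Monitors G v y e →
      ∃ x ∈ M \ {v}, ∃ y ∈ M \ {v}, Monitors G x y e := by
    intro e y hy h
    by_cases hyu : y = u
    · subst hyu
      obtain ⟨z, hzM, hzu, hzv⟩ := hz
      rw [adj_monitors hadj h.symm']
      exact ⟨y, ⟨huM, huv⟩, z, ⟨hzM, hzv⟩, leaf_monitors_edge hu hadj hzu⟩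
    · exact ⟨u, ⟨huM, huv⟩, y, ⟨hy, h.1.symm⟩, leaf_monitors hconn hu hadj hyu h⟩
  intro e he
  obtain ⟨x, hx, y, hy, h⟩ := hM e he
  by_cases hxv : x = v
  · exact main e y hy (hxv ▸ h)
  by_cases hyv : y = v
  · exact main e x hx (hyv ▸ h.symm')
  exact ⟨x, ⟨hx, hxv⟩, y, ⟨hy, hyv⟩, h⟩
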